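/- arXiv:math/0203223 — 6 statements merged into one kernel-verified Lean document; each statement's English description precedes it below -/
import Mathlib

section
/- For k ∈ (0,1), set k' = √(1−k²), e₁ = (2−k²)/(3kk'), e₃ = (2k²−1)/(3kk'), g₂ = 4(1−k²+k⁴)/(3k²k'²) and g₃ = 4(k²−2)(k²+1)(2k²−1)/(27k³k'³). Then for every p ∈ ℂ: (1 + 2(k'/k)(p − e₃) − (p − e₃)²)² = (6p² − g₂/2)²/4 − (4p³ − g₂p − g₃)(2p + e₁). -/
/-- Squared form of identity (10) of Lemma 4.3:
`(1 + 2(k'/k)(p − e₃) − (p − e₃)²)² = (6p² − g₂/2)²/4 − (4p³ − g₂p − g₃)(2p + e₁)`. -/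
theorem stmt2 (k k' e₁ e₃ g₂ g₃ : ℝ) (hk0 : 0 < k) (hk1 : k < 1)
    (hk' : k' = Real.sqrt (1 - k ^ 2))
    (he₁ : e₁ = (2 - k ^ 2) / (3 * k * k'))
    (he₃ : e₃ = (2 * k ^ 2 - 1) / (3 * k * k'))
    (hg₂ : g₂ = 4 * (1 - k ^ 2 + k ^ 4) / (3 * k ^ 2 * k' ^ 2))
    (hg₃ : g₃ = 4 * (k ^ 2 - 2) * (k ^ 2 + 1) * (2 * k ^ 2 - 1) / (27 * k ^ 3 * k' ^ 3)) :
    ∀ p : ℂ,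
      (1 + 2 * ((k' : ℂ) / (k : ℂ)) * (p - (e₃ : ℂ)) - (p - (e₃ : ℂ)) ^ 2) ^ 2
        = (6 * p ^ 2 - (g₂ : ℂ) / 2) ^ 2 / 4
          - (4 * p ^ 3 - (g₂ : ℂ) * p - (g₃ : ℂ)) * (2 * p + (e₁ : ℂ)) := by
  have hsq : k' ^ 2 = 1 - k ^ 2 := by
    rw [hk', Real.sq_sqrt (by nlinarith)]
  have hk'0 : k' ≠ 0 := by
    rw [hk']
    exact (Real.sqrt_pos.mpr (by nlinarith)).ne'
  have hk : k ≠ 0 := hk0.ne'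
  have hone : 1 = k ^ 2 + k' ^ 2 := by linarith
  obtain ⟨c, hc⟩ : ∃ c, c = k' / k := ⟨_, rfl⟩
  have hc0 : c ≠ 0 := hc ▸ div_ne_zero hk'0 hk
  have hkc : k' = c * k := by rw [hc]; field_simp
  have hkc1 : k ^ 2 * (1 + c ^ 2) = 1 := by rw [hkc] at hone; linarith
  have h₁ : e₁ = (1 / c + 2 * c) / 3 := by
    rw [he₁, hkc]
    field_simp
    linear_combination (-2) * hkc1
  have h₃ : e₃ = (1 / c - c) / 3 := by
    rw [he₃, hkc]
    field_simp
    linear_combination hkc1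
  have h₂ : g₂ = 4 / 3 * (1 / c ^ 2 + 1 + c ^ 2) := by
    have h : 1 - k ^ 2 + k ^ 4 = k ^ 4 * (1 + c ^ 2 + c ^ 4) := by
      linear_combination (k ^ 2 - 1 - k ^ 2 * (1 + c ^ 2)) * hkc1
    rw [hg₂, hkc, h]
    field_simp
  have h₄ : g₃ = -(4 / 27) * (1 / c + 2 * c) * (2 / c + c) * (1 / c - c) := by
    have ha : k ^ 2 - 2 = -(k ^ 2 * (1 + 2 * c ^ 2)) := by linear_combination 2 * hkc1
    have hb : k ^ 2 + 1 = k ^ 2 * (2 + c ^ 2) := by linear_combination -hkc1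
    have hd : 2 * k ^ 2 - 1 = k ^ 2 * (1 - c ^ 2) := by linear_combination hkc1
    rw [hg₃, hkc, ha, hb, hd]
    field_simp
  intro p
  have hcC : (c : ℂ) ≠ 0 := by exact_mod_cast hc0
  rw [← Complex.ofReal_div, ← hc, h₁, h₂, h₃, h₄]
  push_cast
  field_simp
  ring
end

section
/- For k ∈ (0,1), set k' = √(1−k²), e₂ = −(1+k²)/(3kk'), e₃ = (2k²−1)/(3kk'), g₂ = 4(1−k²+k⁴)/(3k²k'²) and g₃ = 4(k²−2)(k²+1)(2k²−1)/(27k³k'³). Then for every p ∈ ℂ: (−1 + 2(k/k')(p − e₃) + (p − e₃)²)² = (6p² − g₂/2)²/4 − (4p³ − g₂p − g₃)(2p + e₂). -/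
/-- Duplication identity for a Weierstrass cubic with roots `-a - b`, `a`, `b`. -/
lemma sq_shift_sub_eq_duplication {R : Type*} [Field R] [CharZero R] (a b p : R) :
    ((p - a) ^ 2 - (2 * a + b) * (a - b)) ^ 2
      = (6 * p ^ 2 - 4 * (a ^ 2 + a * b + b ^ 2) / 2) ^ 2 / 4
        - (4 * p ^ 3 - 4 * (a ^ 2 + a * b + b ^ 2) * p - -4 * (a + b) * a * b) * (2 * p + a) := by
  ring

/-- Squared form of identity (11) of Lemma 4.3:
`(−1 + 2(k/k')(p − e₃) + (p − e₃)²)² = (6p² − g₂/2)²/4 − (4p³ − g₂p − g₃)(2p + e₂)`. -/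
theorem stmt3 (k k' e₂ e₃ g₂ g₃ : ℝ) (hk0 : 0 < k) (hk1 : k < 1)
    (hk' : k' = Real.sqrt (1 - k ^ 2))
    (he₂ : e₂ = -(1 + k ^ 2) / (3 * k * k'))
    (he₃ : e₃ = (2 * k ^ 2 - 1) / (3 * k * k'))
    (hg₂ : g₂ = 4 * (1 - k ^ 2 + k ^ 4) / (3 * k ^ 2 * k' ^ 2))
    (hg₃ : g₃ = 4 * (k ^ 2 - 2) * (k ^ 2 + 1) * (2 * k ^ 2 - 1) / (27 * k ^ 3 * k' ^ 3)) :
    ∀ p : ℂ,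
      (-1 + 2 * ((k : ℂ) / (k' : ℂ)) * (p - (e₃ : ℂ)) + (p - (e₃ : ℂ)) ^ 2) ^ 2
        = (6 * p ^ 2 - (g₂ : ℂ) / 2) ^ 2 / 4
          - (4 * p ^ 3 - (g₂ : ℂ) * p - (g₃ : ℂ)) * (2 * p + (e₂ : ℂ)) := by
  intro p
  have hpos : 0 < 1 - k ^ 2 := by nlinarith
  have hk'0 : k' ≠ 0 := by
    rw [hk']
    exact (Real.sqrt_pos.mpr hpos).ne'
  have hsq : k' ^ 2 = 1 - k ^ 2 := by rw [hk', Real.sq_sqrt hpos.le]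
  have hk : k ≠ 0 := hk0.ne'
  have hdiv : k / k' = e₃ - e₂ := by
    rw [he₂, he₃]
    field_simp
    ring
  have hprod : (2 * e₂ + e₃) * (e₂ - e₃) = 1 + (e₃ - e₂) ^ 2 := by
    have hinv : (2 * e₂ + e₃) * (e₂ - e₃) = 1 / k' ^ 2 := by
      rw [he₂, he₃]
      field_simp
      ring
    rw [hinv, ← hdiv]
    field_simp
    linear_combination -hsq
  have hg₂' : g₂ = 4 * (e₂ ^ 2 + e₂ * e₃ + e₃ ^ 2) := by
    rw [hg₂, he₂, he₃]
    field_simp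
    ring
  have hg₃' : g₃ = -4 * (e₂ + e₃) * e₂ * e₃ := by
    rw [hg₃, he₂, he₃]
    field_simp
    ring
  have hprodC : (2 * (e₂ : ℂ) + e₃) * (e₂ - e₃) = 1 + ((e₃ : ℂ) - e₂) ^ 2 := by
    exact_mod_cast congrArg Complex.ofReal hprod
  have hdivC : (k : ℂ) / k' = e₃ - e₂ := by
    exact_mod_cast congrArg Complex.ofReal hdiv
  have hdup := sq_shift_sub_eq_duplication (e₂ : ℂ) e₃ p
  rw [hprodC] at hdup
  rw [hdivC, hg₂', hg₃']
  push_cast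
  rw [← hdup]
  ring
end

section
/- For k ∈ (0,1), set k' = √(1−k²), e₃ = (2k²−1)/(3kk'), g₂ = 4(1−k²+k⁴)/(3k²k'²) and g₃ = 4(k²−2)(k²+1)(2k²−1)/(27k³k'³). Then for every p ∈ ℂ: (1 + (p − e₃)²)² = (6p² − g₂/2)²/4 − (4p³ − g₂p − g₃)(2p + e₃). -/
/-- Squared form of identity (12) of Lemma 4.3:
`(1 + (p − e₃)²)² = (6p² − g₂/2)²/4 − (4p³ − g₂p − g₃)(2p + e₃)`. -/
theorem stmt4 (k k' e₃ g₂ g₃ : ℝ) (hk0 : 0 < k) (hk1 : k < 1)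
    (hk' : k' = Real.sqrt (1 - k ^ 2))
    (he₃ : e₃ = (2 * k ^ 2 - 1) / (3 * k * k'))
    (hg₂ : g₂ = 4 * (1 - k ^ 2 + k ^ 4) / (3 * k ^ 2 * k' ^ 2))
    (hg₃ : g₃ = 4 * (k ^ 2 - 2) * (k ^ 2 + 1) * (2 * k ^ 2 - 1) / (27 * k ^ 3 * k' ^ 3)) :
    ∀ p : ℂ,
      (1 + (p - (e₃ : ℂ)) ^ 2) ^ 2
        = (6 * p ^ 2 - (g₂ : ℂ) / 2) ^ 2 / 4
          - (4 * p ^ 3 - (g₂ : ℂ) * p - (g₃ : ℂ)) * (2 * p + (e₃ : ℂ)) := by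
  have hk'_sq : k' ^ 2 = 1 - k ^ 2 := by
    rw [hk', Real.sq_sqrt (by nlinarith)]
  have hk_ne : k ≠ 0 := hk0.ne'
  have hk'_ne : k' ≠ 0 := by
    rw [hk']
    exact (Real.sqrt_pos.mpr (by nlinarith)).ne'
  have hg₂e : g₂ = 12 * e₃ ^ 2 + 4 := by
    rw [hg₂, he₃]
    field_simp
    rw [hk'_sq]
    ring
  have hg₃e : g₃ = -8 * e₃ ^ 3 - 4 * e₃ := by
    rw [hg₃, he₃]
    field_simp
    rw [hk'_sq]
    ring
  intro p
  rw [hg₂e, hg₃e]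
  push_cast
  ring
end

section
/- Let e₃ ∈ ℂ, g₂ = 4(1 + 3e₃²), g₃ = −4e₃(1 + 2e₃²), and ω₁ ∈ ℂ. Let U ⊆ ℂ be open and p : U → ℂ analytic with p'(u)² = 4p(u)³ − g₂p(u) − g₃ for all u ∈ U. Put g = p − e₃, f = (ω₁/4)p', and define (at points where p' ≠ 0) df/dg = f'/g' and d²f/dg² = (f'/g')'/g'. Then at every u ∈ U with p'(u) ≠ 0, the second Weierstrass-representation component Ω₂(u) = (i/2)(−(1/2)(1 + g(u)²)(d²f/dg²)(u) + g(u)(df/dg)(u) − f(u)) equals (iω₁/4)((1 + g(u)²)/g'(u))³. -/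
/-- A solution of `p'² = 4p³ − ap − b` satisfies `p'' = 6p² − a/2` away from its critical points. -/
theorem second_deriv_of_weierstrass_ode {a b c v : ℂ} {U : Set ℂ} {p p₁ : ℂ → ℂ}
    (hU : U ∈ nhds v) (hp : HasDerivAt p (p₁ v) v) (hp₁ : HasDerivAt p₁ c v)
    (hode : ∀ u ∈ U, (p₁ u) ^ 2 = 4 * (p u) ^ 3 - a * p u - b) (hne : p₁ v ≠ 0) :
    c = 6 * p v ^ 2 - a / 2 := by
  have hev : (fun u => p₁ u ^ 2) =ᶠ[nhds v] fun u => 4 * p u ^ 3 - a * p u - b :=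
    Filter.mem_of_superset hU hode
  have h := (((hp.pow 3).const_mul 4).sub (hp.const_mul a)).sub_const b
  have key := ((hp₁.pow 2).congr_of_eventuallyEq hev.symm).unique h
  push_cast at key
  apply mul_left_cancel₀ hne
  linear_combination key / 2

/-- Lemma 4.4: substituting `g = p − e₃`, `f = (ω₁/4)p'` (with `p` analytic satisfying
`p'² = 4p³ − g₂p − g₃`, `g₂ = 4(1 + 3e₃²)`, `g₃ = −4e₃(1 + 2e₃²)`) into the second
Weierstrass-representation component
`Ω₂ = (i/2)(−(1/2)(1 + g²)·d²f/dg² + g·df/dg − f)` yields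
`Ω₂(u) = (iω₁/4)((1 + g(u)²)/g'(u))³`.
Here `p₁, p₂, p₃` are the successive derivatives of `p`, `df/dg = f'/g' = (ω₁/4)p₂/p₁`, and
`d²f/dg² = (f'/g')'/g'` is expressed with `deriv`. -/
theorem stmt6 (e₃ g₂ g₃ ω₁ : ℂ) (hg₂ : g₂ = 4 * (1 + 3 * e₃ ^ 2))
    (hg₃ : g₃ = -4 * e₃ * (1 + 2 * e₃ ^ 2))
    (U : Set ℂ) (hU : IsOpen U) (p p₁ p₂ p₃ : ℂ → ℂ)
    (hp : ∀ u ∈ U, HasDerivAt p (p₁ u) u)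
    (hp₁ : ∀ u ∈ U, HasDerivAt p₁ (p₂ u) u)
    (hp₂ : ∀ u ∈ U, HasDerivAt p₂ (p₃ u) u)
    (hode : ∀ u ∈ U, (p₁ u) ^ 2 = 4 * (p u) ^ 3 - g₂ * p u - g₃) :
    ∀ u ∈ U, p₁ u ≠ 0 →
      (Complex.I / 2) *
          (-(1 / 2) * (1 + (p u - e₃) ^ 2) *
              ((deriv (fun v => (ω₁ / 4 * p₂ v) / p₁ v) u) / p₁ u)
            + (p u - e₃) * ((ω₁ / 4 * p₂ u) / p₁ u) - ω₁ / 4 * p₁ u)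
        = (Complex.I * ω₁ / 4) * ((1 + (p u - e₃) ^ 2) / p₁ u) ^ 3 := by
  subst hg₂ hg₃
  intro u hu hne
  have hq : ∀ v ∈ U, p₁ v ≠ 0 → p₂ v = 6 * p v ^ 2 - 4 * (1 + 3 * e₃ ^ 2) / 2 :=
    fun v hv hv' => second_deriv_of_weierstrass_ode (hU.mem_nhds hv) (hp v hv) (hp₁ v hv) hode hv'
  have hev : p₂ =ᶠ[nhds u] fun v => 6 * p v ^ 2 - 4 * (1 + 3 * e₃ ^ 2) / 2 := by
    filter_upwards [hU.mem_nhds hu, (hp₁ u hu).continuousAt.eventually_ne hne] with v hv hv'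
    exact hq v hv hv'
  have h3 : p₃ u = 12 * p u * p₁ u := by
    have h := (((hp u hu).pow 2).const_mul 6).sub_const (4 * (1 + 3 * e₃ ^ 2) / 2)
    rw [((hp₂ u hu).congr_of_eventuallyEq hev.symm).unique h]
    push_cast
    ring
  have h2 := hq u hu hne
  have h1 := hode u hu
  have hd : deriv (fun v => (ω₁ / 4 * p₂ v) / p₁ v) u =
      (ω₁ / 4 * p₃ u * p₁ u - ω₁ / 4 * p₂ u * p₂ u) / p₁ u ^ 2 :=
    (((hp₂ u hu).const_mul (ω₁ / 4)).div (hp₁ u hu) hne).deriv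
  rw [hd, h3, h2]
  generalize p₁ u = y at *
  generalize p u = x at *
  have hy4 : y ^ 4 = (4 * x ^ 3 - 4 * (1 + 3 * e₃ ^ 2) * x - -4 * e₃ * (1 + 2 * e₃ ^ 2)) ^ 2 := by
    rw [← h1]
    ring
  field_simp
  ring_nf
  simp only [hy4, h1]
  ring
end

section
/- For k ∈ (0,1), set k' = √(1−k²), e₁ = (2−k²)/(3kk'), e₂ = −(1+k²)/(3kk'), e₃ = (2k²−1)/(3kk'). Let U ⊆ ℂ be open and P, F₁, F₂, F₃ : U → ℂ differentiable, with each F_j nowhere vanishing, F_j(u)² = P(u) − e_j for j = 1,2,3 and all u ∈ U, and P' = 4F₁F₂F₃ on U. Then the function g = −(k'F₂ + ikF₁)/F₃ is differentiable on U and satisfies g'(u) = 2ig(u)/F₃(u) for all u ∈ U. -/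
/-- If `F ^ 2 = P - e` near `u`, the derivative of `F` is that of `P` divided by `2 * F u`. -/
theorem hasDerivAt_of_sq_eq_sub_const {U : Set ℂ} (hU : IsOpen U) {P F : ℂ → ℂ} {e D u : ℂ}
    (hu : u ∈ U) (hd : DifferentiableAt ℂ F u) (hn : F u ≠ 0)
    (hF : ∀ v ∈ U, F v ^ 2 = P v - e) (hP : HasDerivAt P (2 * F u * D) u) :
    HasDerivAt F D u := by
  have hsq : HasDerivAt (fun v => F v ^ 2) (2 * F u * D) u :=
    (hP.sub_const e).congr_of_eventuallyEq (Filter.eventually_of_mem (hU.mem_nhds hu) hF)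
  have hpow : HasDerivAt (fun v => F v ^ 2) (2 * F u * deriv F u) u := by
    simpa using hd.hasDerivAt.fun_pow 2
  have h : deriv F u = D :=
    mul_left_cancel₀ (mul_ne_zero two_ne_zero hn) (hpow.unique hsq)
  exact h ▸ hd.hasDerivAt


/-- Proposition 8.1(ii): with `P, F₁, F₂, F₃` differentiable on the open set `U`, each `F_j`
nowhere vanishing, `F_j² = P − e_j` and `P' = 4F₁F₂F₃`, the function
`g = −(k'F₂ + ikF₁)/F₃` is differentiable on `U` with `g' = 2ig/F₃`. -/
theorem stmt9 (k k' e₁ e₂ e₃ : ℝ) (hk0 : 0 < k) (hk1 : k < 1)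
    (hk' : k' = Real.sqrt (1 - k ^ 2))
    (he₁ : e₁ = (2 - k ^ 2) / (3 * k * k'))
    (he₂ : e₂ = -(1 + k ^ 2) / (3 * k * k'))
    (he₃ : e₃ = (2 * k ^ 2 - 1) / (3 * k * k'))
    (U : Set ℂ) (hU : IsOpen U) (P F₁ F₂ F₃ : ℂ → ℂ)
    (hd₁ : ∀ u ∈ U, DifferentiableAt ℂ F₁ u)
    (hd₂ : ∀ u ∈ U, DifferentiableAt ℂ F₂ u)
    (hd₃ : ∀ u ∈ U, DifferentiableAt ℂ F₃ u)
    (hn₁ : ∀ u ∈ U, F₁ u ≠ 0) (hn₂ : ∀ u ∈ U, F₂ u ≠ 0) (hn₃ : ∀ u ∈ U, F₃ u ≠ 0)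
    (hF₁ : ∀ u ∈ U, (F₁ u) ^ 2 = P u - (e₁ : ℂ))
    (hF₂ : ∀ u ∈ U, (F₂ u) ^ 2 = P u - (e₂ : ℂ))
    (hF₃ : ∀ u ∈ U, (F₃ u) ^ 2 = P u - (e₃ : ℂ))
    (hP : ∀ u ∈ U, HasDerivAt P (4 * F₁ u * F₂ u * F₃ u) u) :
    (∀ u ∈ U, DifferentiableAt ℂ
        (fun v => -((k' : ℂ) * F₂ v + Complex.I * (k : ℂ) * F₁ v) / F₃ v) u) ∧
    ∀ u ∈ U, HasDerivAt
        (fun v => -((k' : ℂ) * F₂ v + Complex.I * (k : ℂ) * F₁ v) / F₃ v)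
        (2 * Complex.I * (-((k' : ℂ) * F₂ u + Complex.I * (k : ℂ) * F₁ u) / F₃ u) / F₃ u)
        u := by
  have hk'0 : k' ≠ 0 := by
    rw [hk']
    exact (Real.sqrt_pos.2 (by nlinarith)).ne'
  have hk'2 : k' ^ 2 = 1 - k ^ 2 := by
    rw [hk']
    exact Real.sq_sqrt (by nlinarith)
  have h₃₂ : (k' : ℂ) * (e₃ - e₂) = k := by
    have h : k' * (e₃ - e₂) = k := by
      rw [he₂, he₃]
      field_simp
      ring
    exact_mod_cast h
  have h₃₁ : (k : ℂ) * (e₃ - e₁) = -k' := by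
    have h : k * (e₃ - e₁) = -k' := by
      rw [he₁, he₃]
      field_simp
      linear_combination 3 * hk'2
    exact_mod_cast h
  suffices hg : ∀ u ∈ U, HasDerivAt
      (fun v => -((k' : ℂ) * F₂ v + Complex.I * (k : ℂ) * F₁ v) / F₃ v)
      (2 * Complex.I * (-((k' : ℂ) * F₂ u + Complex.I * (k : ℂ) * F₁ u) / F₃ u) / F₃ u) u from
    ⟨fun u hu => (hg u hu).differentiableAt, hg⟩
  intro u hu
  have h₁ : HasDerivAt F₁ (2 * F₂ u * F₃ u) u :=
    hasDerivAt_of_sq_eq_sub_const hU hu (hd₁ u hu) (hn₁ u hu) hF₁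
      ((hP u hu).congr_deriv (by ring))
  have h₂ : HasDerivAt F₂ (2 * F₁ u * F₃ u) u :=
    hasDerivAt_of_sq_eq_sub_const hU hu (hd₂ u hu) (hn₂ u hu) hF₂
      ((hP u hu).congr_deriv (by ring))
  have h₃ : HasDerivAt F₃ (2 * F₁ u * F₂ u) u :=
    hasDerivAt_of_sq_eq_sub_const hU hu (hd₃ u hu) (hn₃ u hu) hF₃
      ((hP u hu).congr_deriv (by ring))
  have hn := hn₃ u hu
  refine (((h₂.const_mul (k' : ℂ)).fun_add
    (h₁.const_mul (Complex.I * (k : ℂ)))).fun_neg.fun_div h₃ hn).congr_deriv ?_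
  field_simp
  linear_combination k' * F₁ u * (hF₂ u hu - hF₃ u hu) +
    Complex.I * k * F₂ u * (hF₁ u hu - hF₃ u hu) +
    F₁ u * h₃₂ + Complex.I * F₂ u * h₃₁ + k * F₁ u * Complex.I_sq
end

section
/- Let K(k) = ∫₀^{π/2} (1 − k² sin²ψ)^{−1/2} dψ for k ∈ (0,1), and define b₁(k) = K(k)/(2k) and b₃(k) = k²K(k)/2. Then e^{K(k)}·(b₁(k) − K(k)/2) → 0 and e^{K(k)}·(K(k)/2 − b₃(k)) → 0 as k → 1⁻. -/
/-- The complete elliptic integral of the first kind,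
`K(k) = ∫₀^{π/2} (1 − k² sin²ψ)^{−1/2} dψ`. -/
noncomputable def ellipticK (k : ℝ) : ℝ :=
  ∫ ψ in (0:ℝ)..(Real.pi / 2), 1 / Real.sqrt (1 - k ^ 2 * Real.sin ψ ^ 2)

theorem one_sub_sq_mul_sin_sq_pos {k : ℝ} (hk0 : 0 < k) (hk1 : k < 1) (ψ : ℝ) :
    0 < 1 - k ^ 2 * Real.sin ψ ^ 2 := by
  nlinarith [Real.sin_sq_add_cos_sq ψ, sq_nonneg (Real.cos ψ), sq_nonneg (Real.sin ψ), sq_nonneg k]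

theorem ellipticK_nonneg (k : ℝ) : 0 ≤ ellipticK k :=
  intervalIntegral.integral_nonneg (by positivity) fun ψ _ => by positivity

theorem hasDerivAt_arsinh_mul_cos {k : ℝ} (hk0 : 0 < k) (hk1 : k < 1) (ψ : ℝ) :
    HasDerivAt (fun ψ => (ψ - Real.arsinh (k / √(1 - k ^ 2) * Real.cos ψ)) / k)
      (1 / k + Real.sin ψ / √(1 - k ^ 2 * Real.sin ψ ^ 2)) ψ := by
  have hm : 0 < 1 - k ^ 2 := by nlinarith
  have hr : 0 < √(1 - k ^ 2) := Real.sqrt_pos.2 hm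
  have hD : 0 < √(1 - k ^ 2 * Real.sin ψ ^ 2) :=
    Real.sqrt_pos.2 (one_sub_sq_mul_sin_sq_pos hk0 hk1 ψ)
  have hsq : √(1 + (k / √(1 - k ^ 2) * Real.cos ψ) ^ 2) =
      √(1 - k ^ 2 * Real.sin ψ ^ 2) / √(1 - k ^ 2) := by
    rw [← Real.sqrt_div' _ hm.le]
    congr 1
    rw [mul_pow, div_pow, Real.sq_sqrt hm.le, Real.cos_sq']
    field_simp
    ring
  have h := ((hasDerivAt_id ψ).sub
    (((Real.hasDerivAt_cos ψ).const_mul (k / √(1 - k ^ 2))).arsinh)).div_const k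
  refine h.congr_deriv ?_
  rw [hsq, smul_eq_mul]
  field_simp
  ring

theorem ellipticK_le {k : ℝ} (hk0 : 0 < k) (hk1 : k < 1) :
    ellipticK k ≤ (Real.pi / 2 + Real.log ((1 + k) / √(1 - k ^ 2))) / k := by
  have hm : 0 < 1 - k ^ 2 := by nlinarith
  have hr : 0 < √(1 - k ^ 2) := Real.sqrt_pos.2 hm
  have hD : ∀ ψ, 0 < √(1 - k ^ 2 * Real.sin ψ ^ 2) := fun ψ =>
    Real.sqrt_pos.2 (one_sub_sq_mul_sin_sq_pos hk0 hk1 ψ)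
  have hc : Continuous fun ψ => √(1 - k ^ 2 * Real.sin ψ ^ 2) := by fun_prop
  have hf : Continuous fun ψ => 1 / √(1 - k ^ 2 * Real.sin ψ ^ 2) :=
    continuous_const.div hc fun ψ => (hD ψ).ne'
  have hg : Continuous fun ψ => 1 / k + Real.sin ψ / √(1 - k ^ 2 * Real.sin ψ ^ 2) :=
    continuous_const.add (Real.continuous_sin.div hc fun ψ => (hD ψ).ne')
  have harsinh : Real.arsinh (k / √(1 - k ^ 2)) = Real.log ((1 + k) / √(1 - k ^ 2)) := by
    have hsq : √(1 + (k / √(1 - k ^ 2)) ^ 2) = 1 / √(1 - k ^ 2) := by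
      rw [← Real.sqrt_one, ← Real.sqrt_div' _ (by simpa using hm.le), Real.sqrt_one]
      congr 1
      rw [div_pow, Real.sq_sqrt hm.le]
      field_simp
      ring
    rw [Real.arsinh, hsq, ← add_div, add_comm k 1]
  calc ellipticK k
      ≤ ∫ ψ in (0:ℝ)..(Real.pi / 2),
          (1 / k + Real.sin ψ / √(1 - k ^ 2 * Real.sin ψ ^ 2)) := by
        refine intervalIntegral.integral_mono_on (by positivity)
          (hf.intervalIntegrable _ _) (hg.intervalIntegrable _ _) fun ψ hψ => ?_
        have hs : 0 ≤ Real.sin ψ :=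
          Real.sin_nonneg_of_nonneg_of_le_pi hψ.1 (by linarith [hψ.2, Real.pi_pos])
        have hs1 := Real.sin_le_one ψ
        have key : k * (1 - Real.sin ψ) ≤ √(1 - k ^ 2 * Real.sin ψ ^ 2) := by
          apply Real.le_sqrt_of_sq_le
          nlinarith [mul_nonneg (sq_nonneg k) (mul_nonneg hs (sub_nonneg.2 hs1))]
        rw [← sub_le_iff_le_add, ← sub_div, div_le_div_iff₀ (hD ψ) hk0]
        linarith
    _ = _ := by
        rw [intervalIntegral.integral_eq_sub_of_hasDerivAt
          (fun ψ _ => hasDerivAt_arsinh_mul_cos hk0 hk1 ψ) (hg.intervalIntegrable _ _)]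
        simp only [Real.cos_pi_div_two, Real.cos_zero, mul_zero, mul_one, Real.arsinh_zero,
          harsinh]
        ring

theorem exp_ellipticK_mul_le {k : ℝ} (hk0 : 3 / 4 ≤ k) (hk1 : k < 1) :
    Real.exp (ellipticK k) * (ellipticK k * (1 - k ^ 2)) ≤
      4 * Real.exp (5 / 3 * (Real.pi / 2 + Real.log 2)) * (1 - k ^ 2) ^ (1 / 6 : ℝ) := by
  have hm : 0 < 1 - k ^ 2 := by nlinarith
  have hr : 0 < √(1 - k ^ 2) := Real.sqrt_pos.2 hm
  have hK : 5 / 4 * ellipticK k ≤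
      5 / 3 * (Real.pi / 2 + Real.log 2) - 5 / 6 * Real.log (1 - k ^ 2) := by
    have hle := ellipticK_le (by linarith) hk1
    rw [le_div_iff₀ (by linarith), Real.log_div (by linarith) hr.ne', Real.log_sqrt hm.le] at hle
    have hlog : Real.log (1 + k) ≤ Real.log 2 := Real.log_le_log (by linarith) (by linarith)
    nlinarith [mul_nonneg (ellipticK_nonneg k) (sub_nonneg.2 hk0)]
  have hKexp : ellipticK k ≤ 4 * Real.exp (1 / 4 * ellipticK k) := by
    linarith [Real.add_one_le_exp (1 / 4 * ellipticK k)]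
  calc Real.exp (ellipticK k) * (ellipticK k * (1 - k ^ 2))
      ≤ Real.exp (ellipticK k) * (4 * Real.exp (1 / 4 * ellipticK k) * (1 - k ^ 2)) := by gcongr
    _ = 4 * Real.exp (5 / 4 * ellipticK k) * (1 - k ^ 2) := by
        rw [show 5 / 4 * ellipticK k = ellipticK k + 1 / 4 * ellipticK k by ring, Real.exp_add]
        ring
    _ ≤ 4 * Real.exp (5 / 3 * (Real.pi / 2 + Real.log 2) - 5 / 6 * Real.log (1 - k ^ 2)) *
          (1 - k ^ 2) := by gcongr
    _ = _ := by
        rw [Real.rpow_def_of_pos hm]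
        nth_rewrite 2 [← Real.exp_log hm]
        rw [mul_assoc, mul_assoc, ← Real.exp_add, ← Real.exp_add]
        ring_nf

theorem tendsto_exp_ellipticK_mul :
    Filter.Tendsto (fun k : ℝ => Real.exp (ellipticK k) * (ellipticK k * (1 - k ^ 2)))
      (nhdsWithin 1 (Set.Iio 1)) (nhds 0) := by
  have hlim : Filter.Tendsto (fun k : ℝ => 4 * Real.exp (5 / 3 * (Real.pi / 2 + Real.log 2)) *
      (1 - k ^ 2) ^ (1 / 6 : ℝ)) (nhdsWithin 1 (Set.Iio 1)) (nhds 0) := by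
    have hcont : Continuous fun k : ℝ => 4 * Real.exp (5 / 3 * (Real.pi / 2 + Real.log 2)) *
        (1 - k ^ 2) ^ (1 / 6 : ℝ) :=
      continuous_const.mul ((by fun_prop : Continuous fun k : ℝ => 1 - k ^ 2).rpow_const
        fun _ => Or.inr (by norm_num))
    have h := hcont.tendsto 1
    norm_num at h
    norm_num
    exact h.mono_left nhdsWithin_le_nhds
  refine squeeze_zero' ?_ ?_ hlim <;>
    filter_upwards [Ico_mem_nhdsLT (by norm_num : (3 / 4 : ℝ) < 1)] with k hk
  · have hm : 0 ≤ 1 - k ^ 2 := by nlinarith [hk.1, hk.2]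
    exact mul_nonneg (Real.exp_pos _).le (mul_nonneg (ellipticK_nonneg k) hm)
  · exact exp_ellipticK_mul_le hk.1 hk.2

/-- Corollary 5.3(b), first bullet: the Higgs branch points `b₁(k) = K(k)/(2k)` and
`b₃(k) = k²K(k)/2` approach the star centre `K(k)/2` exponentially fast relative to the
separation distance `K(k)` as `k → 1⁻`. -/
theorem stmt16 :
    Filter.Tendsto
      (fun k : ℝ => Real.exp (ellipticK k) * (ellipticK k / (2 * k) - ellipticK k / 2))
      (nhdsWithin 1 (Set.Iio 1)) (nhds 0) ∧
    Filter.Tendsto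
      (fun k : ℝ => Real.exp (ellipticK k) * (ellipticK k / 2 - k ^ 2 * ellipticK k / 2))
      (nhdsWithin 1 (Set.Iio 1)) (nhds 0) := by
  constructor
  · refine squeeze_zero' ?_ ?_ tendsto_exp_ellipticK_mul <;>
      filter_upwards [Ico_mem_nhdsLT (by norm_num : (3 / 4 : ℝ) < 1)] with k hk <;>
      have hk0 : 0 < k := by linarith [hk.1]
    all_goals
      have hsub : ellipticK k / (2 * k) - ellipticK k / 2 =
          ellipticK k * ((1 - k) / (2 * k)) := by
        field_simp
      rw [hsub]
    · exact mul_nonneg (Real.exp_pos _).le (mul_nonneg (ellipticK_nonneg k)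
        (div_nonneg (by linarith [hk.2]) (by linarith)))
    · have hle : (1 - k) / (2 * k) ≤ 1 - k ^ 2 := by
        rw [div_le_iff₀ (by linarith)]
        nlinarith [mul_nonneg (sub_nonneg.2 hk.2.le) (sub_nonneg.2 hk.1),
          mul_nonneg (mul_nonneg (sub_nonneg.2 hk.2.le) (sub_nonneg.2 hk.1)) hk0.le]
      exact mul_le_mul_of_nonneg_left
        (mul_le_mul_of_nonneg_left hle (ellipticK_nonneg k)) (Real.exp_pos _).le
  · have h := tendsto_exp_ellipticK_mul.div_const 2
    rw [zero_div] at h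
    refine h.congr fun k => ?_
    ring
end
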